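/- (Claim 3.5) For every ρ ∈ (−1,1) there exists a constant C(ρ) > 0 such that for all integers i, j ≥ 0 with i + j = 3 and all (x,y) ∈ (0,1)², the third partial derivative satisfies |∂³J_ρ(x,y)/∂xⁱ∂yʲ| ≤ C(ρ)·(x·y·(1−x)·(1−y))^{−C(ρ)}. -/

import Mathlib

open MeasureTheory

noncomputable section
namespace DMN

/-- The standard normal CDF `Φ`. -/
def Phi (t : ℝ) : ℝ := ∫ s in Set.Iic t, Real.exp (-s ^ 2 / 2) / Real.sqrt (2 * Real.pi)

/-- The inverse of the standard normal CDF. -/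
def PhiInv : ℝ → ℝ := Function.invFun Phi

/-- `J_ρ(x,y) = P[X ≤ Φ⁻¹(x), Y ≤ Φ⁻¹(y)]` for a centered bivariate Gaussian `(X,Y)`
with unit variances and covariance `ρ`, extended continuously to the boundary of
`[0,1]²`. -/
def J (ρ x y : ℝ) : ℝ :=
  if x = 0 ∨ y = 0 then 0
  else if x = 1 then y
  else if y = 1 then x
  else
    ∫ s in Set.Iic (PhiInv x), ∫ t in Set.Iic (PhiInv y),
      Real.exp (-(s ^ 2 - 2 * ρ * s * t + t ^ 2) / (2 * (1 - ρ ^ 2))) /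
        (2 * Real.pi * Real.sqrt (1 - ρ ^ 2))

/-- Partial derivative in the first variable. -/
def pdx (F : ℝ → ℝ → ℝ) : ℝ → ℝ → ℝ := fun x y => deriv (fun x' => F x' y) x

/-- Partial derivative in the second variable. -/
def pdy (F : ℝ → ℝ → ℝ) : ℝ → ℝ → ℝ := fun x y => deriv (fun y' => F x y') y

/-- Fundamental theorem of calculus for integrals over left half-lines. -/
theorem hasStrictDerivAt_integral_Iic {f : ℝ → ℝ} (hf : Integrable f) (hc : Continuous f) (a : ℝ) :
    HasStrictDerivAt (fun t => ∫ s in Set.Iic t, f s) (f a) a := by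
  have h : (fun t => ∫ s in Set.Iic t, f s) =
      fun t => (∫ s in (0 : ℝ)..t, f s) + ∫ s in Set.Iic 0, f s := by
    ext t
    rw [← intervalIntegral.integral_Iic_sub_Iic hf.integrableOn hf.integrableOn]
    ring
  rw [h]
  exact (intervalIntegral.integral_hasStrictDerivAt_right (hc.intervalIntegrable _ _)
    hc.stronglyMeasurable.stronglyMeasurableAtFilter hc.continuousAt).add_const _

/-- The standard normal density. -/
def gaussDensity (t : ℝ) : ℝ := Real.exp (-t ^ 2 / 2) / Real.sqrt (2 * Real.pi)

theorem gaussDensity_eq_gaussianPDFReal :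
    gaussDensity = ProbabilityTheory.gaussianPDFReal 0 1 := by
  ext t
  simp [gaussDensity, ProbabilityTheory.gaussianPDFReal, div_eq_inv_mul]

theorem integrable_gaussDensity : Integrable gaussDensity :=
  gaussDensity_eq_gaussianPDFReal ▸ ProbabilityTheory.integrable_gaussianPDFReal 0 1

theorem integral_gaussDensity : ∫ t, gaussDensity t = 1 := by
  rw [gaussDensity_eq_gaussianPDFReal]
  exact ProbabilityTheory.integral_gaussianPDFReal_eq_one 0 one_ne_zero

theorem continuous_gaussDensity : Continuous gaussDensity := by
  unfold gaussDensity
  fun_prop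

theorem gaussDensity_pos (t : ℝ) : 0 < gaussDensity t := by
  unfold gaussDensity
  positivity

theorem one_le_sqrt_two_pi : 1 ≤ Real.sqrt (2 * Real.pi) :=
  Real.one_le_sqrt.2 (by linarith [Real.pi_gt_three])

theorem sqrt_two_pi_le_three : Real.sqrt (2 * Real.pi) ≤ 3 :=
  Real.sqrt_le_iff.2 ⟨by norm_num, by linarith [Real.pi_le_four]⟩

theorem gaussDensity_le_one (t : ℝ) : gaussDensity t ≤ 1 := by
  unfold gaussDensity
  rw [div_le_one (by positivity)]
  refine le_trans ?_ one_le_sqrt_two_pi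
  rw [Real.exp_le_one_iff]
  nlinarith [sq_nonneg t]

theorem abs_mul_gaussDensity_le_one (t : ℝ) : |t| * gaussDensity t ≤ 1 := by
  have h : |t| * Real.exp (-t ^ 2 / 2) ≤ 1 := by
    have h1 : |t| ≤ Real.exp (t ^ 2 / 2) := by
      refine le_trans ?_ (Real.add_one_le_exp _)
      nlinarith [sq_abs t, sq_nonneg (|t| - 1)]
    calc |t| * Real.exp (-t ^ 2 / 2)
        ≤ Real.exp (t ^ 2 / 2) * Real.exp (-t ^ 2 / 2) := by gcongr
      _ = 1 := by rw [← Real.exp_add, neg_div, add_neg_cancel, Real.exp_zero]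
  unfold gaussDensity
  rw [← mul_div_assoc, div_le_one (by positivity)]
  exact h.trans one_le_sqrt_two_pi

theorem hasDerivAt_gaussDensity (t : ℝ) : HasDerivAt gaussDensity (-t * gaussDensity t) t := by
  have h : HasDerivAt (fun t : ℝ => -t ^ 2 / 2) (-t) t := by
    refine ((hasDerivAt_pow 2 t).neg.div_const 2).congr_deriv ?_
    push_cast
    ring
  refine (h.exp.div_const (Real.sqrt (2 * Real.pi))).congr_deriv ?_
  unfold gaussDensity
  ring

theorem Phi_eq (t : ℝ) : Phi t = ∫ s in Set.Iic t, gaussDensity s := rfl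

theorem hasStrictDerivAt_Phi (t : ℝ) : HasStrictDerivAt Phi (gaussDensity t) t :=
  hasStrictDerivAt_integral_Iic integrable_gaussDensity continuous_gaussDensity t

theorem continuous_Phi : Continuous Phi :=
  continuous_iff_continuousAt.2 fun t => (hasStrictDerivAt_Phi t).hasDerivAt.continuousAt

theorem strictMono_Phi : StrictMono Phi :=
  strictMono_of_hasDerivAt_pos (fun t => (hasStrictDerivAt_Phi t).hasDerivAt) gaussDensity_pos

theorem Phi_nonneg (t : ℝ) : 0 ≤ Phi t :=
  integral_nonneg fun s => (gaussDensity_pos s).le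

theorem Phi_add_Phi_neg (t : ℝ) : Phi t + Phi (-t) = 1 := by
  have h : Phi (-t) = ∫ s in Set.Ioi t, gaussDensity s := by
    rw [Phi_eq, ← integral_comp_neg_Ioi]
    simp [gaussDensity]
  rw [h, Phi_eq, ← integral_gaussDensity, ← Set.compl_Iic]
  exact integral_add_compl measurableSet_Iic integrable_gaussDensity

theorem Phi_le_one (t : ℝ) : Phi t ≤ 1 := by
  linarith [Phi_add_Phi_neg t, Phi_nonneg (-t)]

theorem Phi_eq_cdf : Phi = ProbabilityTheory.cdf (ProbabilityTheory.gaussianReal 0 1) := by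
  ext t
  rw [ProbabilityTheory.cdf_eq_real, measureReal_def,
    ProbabilityTheory.gaussianReal_apply_eq_integral _ one_ne_zero, ENNReal.toReal_ofReal,
    Phi_eq, gaussDensity_eq_gaussianPDFReal]
  exact integral_nonneg fun s => ProbabilityTheory.gaussianPDFReal_nonneg 0 1 s

theorem tendsto_Phi_atBot : Filter.Tendsto Phi Filter.atBot (nhds 0) :=
  Phi_eq_cdf ▸ ProbabilityTheory.tendsto_cdf_atBot _

theorem tendsto_Phi_atTop : Filter.Tendsto Phi Filter.atTop (nhds 1) :=
  Phi_eq_cdf ▸ ProbabilityTheory.tendsto_cdf_atTop _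

theorem PhiInv_Phi (t : ℝ) : PhiInv (Phi t) = t :=
  Function.leftInverse_invFun strictMono_Phi.injective t

theorem Phi_PhiInv {x : ℝ} (hx : x ∈ Set.Ioo (0 : ℝ) 1) : Phi (PhiInv x) = x := by
  obtain ⟨t, ht⟩ : x ∈ Set.range Phi :=
    mem_range_of_exists_le_of_exists_ge continuous_Phi
      (tendsto_Phi_atBot.eventually (eventually_le_nhds hx.1)).exists
      (tendsto_Phi_atTop.eventually (eventually_ge_nhds hx.2)).exists
  rw [← ht, PhiInv_Phi]

theorem hasDerivAt_PhiInv {x : ℝ} (hx : x ∈ Set.Ioo (0 : ℝ) 1) :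
    HasDerivAt PhiInv (gaussDensity (PhiInv x))⁻¹ x := by
  have h := (hasStrictDerivAt_Phi (PhiInv x)).to_local_left_inverse (gaussDensity_pos _).ne'
    (Filter.Eventually.of_forall PhiInv_Phi)
  rw [Phi_PhiInv hx] at h
  exact h.hasDerivAt

theorem Phi_le_exp_of_nonpos {t : ℝ} (ht : t ≤ 0) : Phi t ≤ Real.exp (-t ^ 2 / 2) := by
  have hint : Integrable fun s => Real.exp (-t ^ 2 / 2) * gaussDensity (s - t) :=
    (integrable_gaussDensity.comp_sub_right t).const_mul _
  calc Phi t ≤ ∫ s in Set.Iic t, Real.exp (-t ^ 2 / 2) * gaussDensity (s - t) := by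
        refine setIntegral_mono_on integrable_gaussDensity.integrableOn hint.integrableOn
          measurableSet_Iic fun s hs => ?_
        have hs' : s ≤ t := hs
        unfold gaussDensity
        rw [← mul_div_assoc, ← Real.exp_add]
        gcongr
        nlinarith [mul_nonneg_of_nonpos_of_nonpos ht (sub_nonpos.2 hs')]
    _ ≤ ∫ s, Real.exp (-t ^ 2 / 2) * gaussDensity (s - t) :=
        setIntegral_le_integral hint (Filter.Eventually.of_forall fun s =>
          mul_nonneg (Real.exp_pos _).le (gaussDensity_pos _).le)
    _ = Real.exp (-t ^ 2 / 2) := by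
        rw [integral_const_mul, integral_sub_right_eq_self, integral_gaussDensity, mul_one]

theorem Phi_mul_one_sub_le (t : ℝ) :
    Phi t * (1 - Phi t) ≤ Real.exp (-t ^ 2 / 2) := by
  have h0 := Phi_nonneg t
  have h1 := Phi_le_one t
  rcases le_total t 0 with ht | ht
  · nlinarith [Phi_le_exp_of_nonpos ht]
  · have h := Phi_le_exp_of_nonpos (neg_nonpos.2 ht)
    rw [neg_sq] at h
    nlinarith [Phi_add_Phi_neg t]

theorem inv_gaussDensity_PhiInv_le {x : ℝ} (hx : x ∈ Set.Ioo (0 : ℝ) 1) :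
    (gaussDensity (PhiInv x))⁻¹ ≤ 3 / (x * (1 - x)) := by
  have h := Phi_mul_one_sub_le (PhiInv x)
  rw [Phi_PhiInv hx] at h
  have hpos : 0 < x * (1 - x) := mul_pos hx.1 (sub_pos.2 hx.2)
  rw [gaussDensity, inv_div]
  exact div_le_div₀ (by norm_num) sqrt_two_pi_le_three hpos h

theorem hasDerivAt_Phi_affine (p c : ℝ) {x : ℝ} (hx : x ∈ Set.Ioo (0 : ℝ) 1) :
    HasDerivAt (fun x' => Phi (p * PhiInv x' + c))
      (p * gaussDensity (p * PhiInv x + c) / gaussDensity (PhiInv x)) x := by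
  refine ((hasStrictDerivAt_Phi _).hasDerivAt.comp x
    (((hasDerivAt_PhiInv hx).const_mul p).add_const c)).congr_deriv ?_
  ring

theorem hasDerivAt_gaussDensity_affine (p c : ℝ) {x : ℝ} (hx : x ∈ Set.Ioo (0 : ℝ) 1) :
    HasDerivAt (fun x' => gaussDensity (p * PhiInv x' + c))
      (-(p * (p * PhiInv x + c) * gaussDensity (p * PhiInv x + c)) / gaussDensity (PhiInv x)) x := by
  refine ((hasDerivAt_gaussDensity _).comp x
    (((hasDerivAt_PhiInv hx).const_mul p).add_const c)).congr_deriv ?_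
  ring

theorem hasDerivAt_gaussDensity_ratio (p c : ℝ) {x : ℝ} (hx : x ∈ Set.Ioo (0 : ℝ) 1) :
    HasDerivAt (fun x' => p * gaussDensity (p * PhiInv x' + c) / gaussDensity (PhiInv x'))
      (p * gaussDensity (p * PhiInv x + c) * (PhiInv x - p * (p * PhiInv x + c)) /
        gaussDensity (PhiInv x) ^ 2) x := by
  have hd : HasDerivAt (fun x' => gaussDensity (PhiInv x')) (-PhiInv x) x := by
    refine ((hasDerivAt_gaussDensity _).comp x (hasDerivAt_PhiInv hx)).congr_deriv ?_
    exact mul_inv_cancel_right₀ (gaussDensity_pos _).ne' _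
  refine (((hasDerivAt_gaussDensity_affine p c hx).const_mul p).div hd
    (gaussDensity_pos _).ne').congr_deriv ?_
  have hne := (gaussDensity_pos (PhiInv x)).ne'
  field_simp
  ring

/-- The bivariate normal density with unit variances and covariance `ρ`. -/
def bivariateDensity (ρ s t : ℝ) : ℝ :=
  Real.exp (-(s ^ 2 - 2 * ρ * s * t + t ^ 2) / (2 * (1 - ρ ^ 2))) /
    (2 * Real.pi * Real.sqrt (1 - ρ ^ 2))

theorem bivariateDensity_swap (ρ s t : ℝ) : bivariateDensity ρ s t = bivariateDensity ρ t s := by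
  unfold bivariateDensity
  congr 3
  ring

theorem one_sub_sq_pos {ρ : ℝ} (hρ0 : -1 < ρ) (hρ1 : ρ < 1) : 0 < 1 - ρ ^ 2 := by
  nlinarith

theorem bivariateDensity_eq {ρ : ℝ} (hρ0 : -1 < ρ) (hρ1 : ρ < 1) (s t : ℝ) :
    bivariateDensity ρ s t = gaussDensity s *
      (gaussDensity ((t - ρ * s) / Real.sqrt (1 - ρ ^ 2)) / Real.sqrt (1 - ρ ^ 2)) := by
  have h := one_sub_sq_pos hρ0 hρ1
  have hexp : -(s ^ 2 - 2 * ρ * s * t + t ^ 2) / (2 * (1 - ρ ^ 2)) =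
      -s ^ 2 / 2 + -((t - ρ * s) / Real.sqrt (1 - ρ ^ 2)) ^ 2 / 2 := by
    rw [div_pow, Real.sq_sqrt h.le]
    field_simp
    ring
  have hpi : 2 * Real.pi = Real.sqrt (2 * Real.pi) * Real.sqrt (2 * Real.pi) :=
    (Real.mul_self_sqrt (by positivity)).symm
  unfold bivariateDensity gaussDensity
  rw [hexp, Real.exp_add, div_div, div_mul_div_comm, ← mul_assoc, ← hpi]

theorem integrable_bivariateDensity {ρ : ℝ} (hρ0 : -1 < ρ) (hρ1 : ρ < 1) :
    Integrable (Function.uncurry (bivariateDensity ρ)) (volume.prod volume) := by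
  have h := one_sub_sq_pos hρ0 hρ1
  have hb : 0 < (1 - |ρ|) / (2 * (1 - ρ ^ 2)) :=
    div_pos (sub_pos.2 (abs_lt.2 ⟨hρ0, hρ1⟩)) (by positivity)
  have hg := integrable_exp_neg_mul_sq hb
  refine ((hg.mul_prod hg).div_const (2 * Real.pi * Real.sqrt (1 - ρ ^ 2))).mono' ?_ ?_
  · refine Continuous.aestronglyMeasurable ?_
    unfold bivariateDensity Function.uncurry
    fun_prop
  · refine Filter.Eventually.of_forall fun z => ?_
    obtain ⟨s, t⟩ := z
    simp only [Function.uncurry, bivariateDensity]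
    rw [Real.norm_of_nonneg (by positivity), ← Real.exp_add]
    gcongr
    have hst : 2 * ρ * s * t ≤ |ρ| * (s ^ 2 + t ^ 2) := by
      have h1 : ρ * (s * t) ≤ |ρ| * |s * t| := by
        rw [← abs_mul]
        exact le_abs_self _
      have h2 : 2 * |s * t| ≤ s ^ 2 + t ^ 2 := by
        rw [abs_mul]
        nlinarith [sq_nonneg (|s| - |t|), sq_abs s, sq_abs t]
      nlinarith [abs_nonneg ρ]
    have e : -((1 - |ρ|) / (2 * (1 - ρ ^ 2))) * s ^ 2 + -((1 - |ρ|) / (2 * (1 - ρ ^ 2))) * t ^ 2 =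
        -((1 - |ρ|) * (s ^ 2 + t ^ 2)) / (2 * (1 - ρ ^ 2)) := by ring
    rw [e]
    gcongr
    linarith

theorem integral_Iic_gaussDensity_div {σ : ℝ} (hσ : 0 < σ) (m b : ℝ) :
    ∫ t in Set.Iic b, gaussDensity ((t - m) / σ) / σ = Phi ((b - m) / σ) := by
  have hlim : Filter.Tendsto (fun t => Phi ((t - m) / σ)) Filter.atBot (nhds 0) :=
    tendsto_Phi_atBot.comp
      ((Filter.tendsto_atBot_add_const_right _ (-m) Filter.tendsto_id).atBot_div_const hσ)
  rw [integral_Iic_of_hasDerivAt_of_tendsto' (f := fun t => Phi ((t - m) / σ)) _ _ hlim, sub_zero]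
  · intro t _
    refine ((hasStrictDerivAt_Phi _).hasDerivAt.comp t
      (((hasDerivAt_id t).sub_const m).div_const σ)).congr_deriv ?_
    simp [div_eq_mul_inv]
  · exact ((((integrable_gaussDensity.comp_div hσ.ne').comp_sub_right m)).div_const σ).integrableOn

theorem integral_Iic_bivariateDensity {ρ : ℝ} (hρ0 : -1 < ρ) (hρ1 : ρ < 1) (s b : ℝ) :
    ∫ t in Set.Iic b, bivariateDensity ρ s t =
      gaussDensity s * Phi ((b - ρ * s) / Real.sqrt (1 - ρ ^ 2)) := by
  simp_rw [bivariateDensity_eq hρ0 hρ1]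
  rw [integral_const_mul,
    integral_Iic_gaussDensity_div (Real.sqrt_pos.2 (one_sub_sq_pos hρ0 hρ1))]

theorem J_eq {ρ x y : ℝ} (hx : x ∈ Set.Ioo (0 : ℝ) 1) (hy : y ∈ Set.Ioo (0 : ℝ) 1) :
    J ρ x y = ∫ s in Set.Iic (PhiInv x), ∫ t in Set.Iic (PhiInv y), bivariateDensity ρ s t := by
  simp only [J, hx.1.ne', hx.2.ne, hy.1.ne', hy.2.ne, or_self, if_false, bivariateDensity]

theorem J_swap {ρ x y : ℝ} (hρ0 : -1 < ρ) (hρ1 : ρ < 1) (hx : x ∈ Set.Ioo (0 : ℝ) 1)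
    (hy : y ∈ Set.Ioo (0 : ℝ) 1) : J ρ x y = J ρ y x := by
  rw [J_eq hx hy, J_eq hy hx, integral_integral_swap]
  · simp_rw [bivariateDensity_swap ρ]
  · rw [Measure.prod_restrict]
    exact (integrable_bivariateDensity hρ0 hρ1).integrableOn

theorem hasDerivAt_J_left {ρ x y : ℝ} (hρ0 : -1 < ρ) (hρ1 : ρ < 1) (hx : x ∈ Set.Ioo (0 : ℝ) 1)
    (hy : y ∈ Set.Ioo (0 : ℝ) 1) :
    HasDerivAt (fun x' => J ρ x' y)
      (Phi ((PhiInv y - ρ * PhiInv x) / Real.sqrt (1 - ρ ^ 2))) x := by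
  have hcont : Continuous fun s =>
      gaussDensity s * Phi ((PhiInv y - ρ * s) / Real.sqrt (1 - ρ ^ 2)) :=
    continuous_gaussDensity.mul (continuous_Phi.comp (by fun_prop))
  have hint : Integrable fun s =>
      gaussDensity s * Phi ((PhiInv y - ρ * s) / Real.sqrt (1 - ρ ^ 2)) := by
    refine integrable_gaussDensity.mono' hcont.aestronglyMeasurable
      (Filter.Eventually.of_forall fun s => ?_)
    rw [Real.norm_of_nonneg (mul_nonneg (gaussDensity_pos s).le (Phi_nonneg _))]
    exact mul_le_of_le_one_right (gaussDensity_pos s).le (Phi_le_one _)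
  have h := (hasStrictDerivAt_integral_Iic hint hcont (PhiInv x)).hasDerivAt.comp x
    (hasDerivAt_PhiInv hx)
  rw [mul_comm, inv_mul_cancel_left₀ (gaussDensity_pos _).ne'] at h
  refine h.congr_of_eventuallyEq ?_
  filter_upwards [isOpen_Ioo.mem_nhds hx] with x' hx'
  simp only [J_eq hx' hy, integral_Iic_bivariateDensity hρ0 hρ1, Function.comp]

theorem pdx_eq_of_hasDerivAt {F G H : ℝ → ℝ → ℝ}
    (hFG : ∀ x ∈ Set.Ioo (0 : ℝ) 1, ∀ y ∈ Set.Ioo (0 : ℝ) 1, F x y = G x y)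
    (hG : ∀ x ∈ Set.Ioo (0 : ℝ) 1, ∀ y ∈ Set.Ioo (0 : ℝ) 1,
      HasDerivAt (fun x' => G x' y) (H x y) x) :
    ∀ x ∈ Set.Ioo (0 : ℝ) 1, ∀ y ∈ Set.Ioo (0 : ℝ) 1, pdx F x y = H x y := by
  intro x hx y hy
  refine ((hG x hx y hy).congr_of_eventuallyEq ?_).deriv
  filter_upwards [isOpen_Ioo.mem_nhds hx] with x' hx' using hFG x' hx' y hy

theorem pdy_eq_of_hasDerivAt {F G H : ℝ → ℝ → ℝ}
    (hFG : ∀ x ∈ Set.Ioo (0 : ℝ) 1, ∀ y ∈ Set.Ioo (0 : ℝ) 1, F x y = G x y)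
    (hG : ∀ x ∈ Set.Ioo (0 : ℝ) 1, ∀ y ∈ Set.Ioo (0 : ℝ) 1,
      HasDerivAt (fun y' => G x y') (H x y) y) :
    ∀ x ∈ Set.Ioo (0 : ℝ) 1, ∀ y ∈ Set.Ioo (0 : ℝ) 1, pdy F x y = H x y := by
  intro x hx y hy
  refine ((hG x hx y hy).congr_of_eventuallyEq ?_).deriv
  filter_upwards [isOpen_Ioo.mem_nhds hy] with y' hy' using hFG x hx y' hy'

theorem pdx_J {ρ : ℝ} (hρ0 : -1 < ρ) (hρ1 : ρ < 1) :
    ∀ x ∈ Set.Ioo (0 : ℝ) 1, ∀ y ∈ Set.Ioo (0 : ℝ) 1, pdx (J ρ) x y =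
      Phi (-ρ / Real.sqrt (1 - ρ ^ 2) * PhiInv x + 1 / Real.sqrt (1 - ρ ^ 2) * PhiInv y) := by
  refine pdx_eq_of_hasDerivAt (fun _ _ _ _ => rfl) fun x hx y hy => ?_
  convert hasDerivAt_J_left hρ0 hρ1 hx hy using 2
  ring

theorem pdy_J {ρ : ℝ} (hρ0 : -1 < ρ) (hρ1 : ρ < 1) :
    ∀ x ∈ Set.Ioo (0 : ℝ) 1, ∀ y ∈ Set.Ioo (0 : ℝ) 1, pdy (J ρ) x y =
      Phi (1 / Real.sqrt (1 - ρ ^ 2) * PhiInv x + -ρ / Real.sqrt (1 - ρ ^ 2) * PhiInv y) := by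
  refine pdy_eq_of_hasDerivAt (fun x hx y hy => J_swap hρ0 hρ1 hx hy) fun x hx y hy => ?_
  convert hasDerivAt_J_left hρ0 hρ1 hy hx using 2
  ring

theorem abs_second_deriv_le {M p w a : ℝ} (hM : 1 ≤ M) (hp : |p| ≤ M) :
    |p * gaussDensity w * (a - p * w) / gaussDensity a ^ 2| ≤
      2 * M ^ 2 * (gaussDensity a)⁻¹ ^ 3 := by
  have ha := gaussDensity_pos a
  have hw := gaussDensity_pos w
  have hinv : 1 ≤ (gaussDensity a)⁻¹ := (one_le_inv₀ ha).2 (gaussDensity_le_one a)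
  have habs : |a| ≤ (gaussDensity a)⁻¹ := by
    rw [← one_div, le_div_iff₀ ha]
    exact abs_mul_gaussDensity_le_one a
  have hmain : gaussDensity w * |a - p * w| ≤ 2 * M * (gaussDensity a)⁻¹ := by
    calc gaussDensity w * |a - p * w|
        ≤ gaussDensity w * (|a| + |p| * |w|) := by
          gcongr
          rw [← abs_mul]
          exact abs_sub _ _
      _ = gaussDensity w * |a| + |p| * (|w| * gaussDensity w) := by ring
      _ ≤ 1 * (gaussDensity a)⁻¹ + M * 1 := by
          gcongr
          · exact gaussDensity_le_one w
          · exact abs_mul_gaussDensity_le_one w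
      _ ≤ 2 * M * (gaussDensity a)⁻¹ := by nlinarith
  rw [abs_div, abs_mul, abs_mul, abs_of_pos hw, abs_of_pos (pow_pos ha 2), mul_assoc, div_eq_mul_inv,
    ← inv_pow]
  calc |p| * (gaussDensity w * |a - p * w|) * (gaussDensity a)⁻¹ ^ 2
      ≤ M * (2 * M * (gaussDensity a)⁻¹) * (gaussDensity a)⁻¹ ^ 2 := by gcongr
    _ = 2 * M ^ 2 * (gaussDensity a)⁻¹ ^ 3 := by ring

theorem abs_mixed_deriv_le {M p q w a b : ℝ} (hp : |p| ≤ M) (hq : |q| ≤ M) :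
    |q * (-(p * w * gaussDensity w) / gaussDensity a) / gaussDensity b| ≤
      M ^ 2 * ((gaussDensity a)⁻¹ * (gaussDensity b)⁻¹) := by
  have ha := gaussDensity_pos a
  have hb := gaussDensity_pos b
  have hM : 0 ≤ M := (abs_nonneg p).trans hp
  have e : |q * (-(p * w * gaussDensity w) / gaussDensity a) / gaussDensity b| =
      |q| * (|p| * (|w| * gaussDensity w)) * ((gaussDensity a)⁻¹ * (gaussDensity b)⁻¹) := by
    rw [abs_div, abs_mul, abs_div, abs_neg, abs_mul, abs_mul, abs_of_pos ha, abs_of_pos hb,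
      abs_of_pos (gaussDensity_pos w)]
    ring
  rw [e]
  calc |q| * (|p| * (|w| * gaussDensity w)) * ((gaussDensity a)⁻¹ * (gaussDensity b)⁻¹)
      ≤ M * (M * 1) * ((gaussDensity a)⁻¹ * (gaussDensity b)⁻¹) := by
        have := gaussDensity_pos w
        gcongr
        exact abs_mul_gaussDensity_le_one w
    _ = _ := by ring

theorem div_cube_le_mul_rpow_neg {K r u v : ℝ} (hK : 54 ≤ K) (hu : 0 < u) (hu1 : u ≤ 1)
    (hv : 0 < v) (hv1 : v ≤ 1) (hr : r ≤ K / (u * v) ^ 3) : r ≤ K * (u * v) ^ (-K) := by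
  refine hr.trans ?_
  rw [div_eq_mul_inv]
  gcongr
  rw [← Real.rpow_natCast, ← Real.rpow_neg (by positivity)]
  refine Real.rpow_le_rpow_of_exponent_ge (by positivity) (mul_le_one₀ hu1 hv.le hv1) ?_
  push_cast
  linarith

/-- The bound for the second partial derivatives of `Φ(p Φ⁻¹(x) + q Φ⁻¹(y))`. -/
theorem second_derivative_bound {M p q : ℝ} (hM : 1 ≤ M) (hp : |p| ≤ M) (hq : |q| ≤ M)
    {F : ℝ → ℝ → ℝ}
    (hF : ∀ x ∈ Set.Ioo (0 : ℝ) 1, ∀ y ∈ Set.Ioo (0 : ℝ) 1,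
      F x y = Phi (p * PhiInv x + q * PhiInv y))
    {x y : ℝ} (hx : x ∈ Set.Ioo (0 : ℝ) 1) (hy : y ∈ Set.Ioo (0 : ℝ) 1) :
    |pdx (pdx F) x y| ≤ 54 * M ^ 2 * (x * y * (1 - x) * (1 - y)) ^ (-(54 * M ^ 2)) ∧
    |pdx (pdy F) x y| ≤ 54 * M ^ 2 * (x * y * (1 - x) * (1 - y)) ^ (-(54 * M ^ 2)) ∧
    |pdy (pdy F) x y| ≤ 54 * M ^ 2 * (x * y * (1 - x) * (1 - y)) ^ (-(54 * M ^ 2)) := by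
  have hFx := pdx_eq_of_hasDerivAt hF fun x hx y _ => hasDerivAt_Phi_affine p (q * PhiInv y) hx
  have hFy := pdy_eq_of_hasDerivAt (fun x hx y hy => (hF x hx y hy).trans
    (congrArg Phi (add_comm (p * PhiInv x) (q * PhiInv y))))
    fun x _ y hy => hasDerivAt_Phi_affine q (p * PhiInv x) hy
  have hFxx := pdx_eq_of_hasDerivAt hFx fun x hx y _ =>
    hasDerivAt_gaussDensity_ratio p (q * PhiInv y) hx
  have hFyy := pdy_eq_of_hasDerivAt hFy fun x _ y hy =>
    hasDerivAt_gaussDensity_ratio q (p * PhiInv x) hy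
  have hFxy := pdx_eq_of_hasDerivAt (F := pdy F) (G := fun x y =>
      q * gaussDensity (p * PhiInv x + q * PhiInv y) / gaussDensity (PhiInv y))
    (fun x hx y hy => by rw [hFy x hx y hy, add_comm]) fun x hx y _ =>
    ((hasDerivAt_gaussDensity_affine p (q * PhiInv y) hx).const_mul q).div_const _
  have hu : 0 < x * (1 - x) := mul_pos hx.1 (sub_pos.2 hx.2)
  have hv : 0 < y * (1 - y) := mul_pos hy.1 (sub_pos.2 hy.2)
  have hu1 : x * (1 - x) ≤ 1 := by nlinarith [hx.1, hx.2]
  have hv1 : y * (1 - y) ≤ 1 := by nlinarith [hy.1, hy.2]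
  have hgx := inv_gaussDensity_PhiInv_le hx
  have hgy := inv_gaussDensity_PhiInv_le hy
  have hgx0 := inv_pos.2 (gaussDensity_pos (PhiInv x))
  have hgy0 := inv_pos.2 (gaussDensity_pos (PhiInv y))
  have hK : 54 ≤ 54 * M ^ 2 := by nlinarith
  rw [show x * y * (1 - x) * (1 - y) = (x * (1 - x)) * (y * (1 - y)) by ring]
  rw [hFxx x hx y hy, hFyy x hx y hy, hFxy x hx y hy]
  generalize x * (1 - x) = u at hu hu1 hgx ⊢
  generalize y * (1 - y) = v at hv hv1 hgy ⊢
  refine ⟨div_cube_le_mul_rpow_neg hK hu hu1 hv hv1 ((abs_second_deriv_le hM hp).trans ?_),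
    div_cube_le_mul_rpow_neg hK hu hu1 hv hv1 ((abs_mixed_deriv_le hp hq).trans ?_),
    div_cube_le_mul_rpow_neg hK hu hu1 hv hv1 ((abs_second_deriv_le hM hq).trans ?_)⟩
  · calc _ ≤ 2 * M ^ 2 * (3 / u) ^ 3 := by gcongr
      _ = 54 * M ^ 2 / u ^ 3 := by ring
      _ ≤ 54 * M ^ 2 / (u * v) ^ 3 := by
        gcongr
        exact mul_le_of_le_one_right hu.le hv1
  · calc _ ≤ M ^ 2 * ((3 / u) * (3 / v)) := by gcongr
      _ = 9 * M ^ 2 / (u * v) := by ring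
      _ ≤ 54 * M ^ 2 / (u * v) ^ 3 := by
        gcongr
        · norm_num
        · exact pow_le_of_le_one (by positivity) (mul_le_one₀ hu1 hv.le hv1) (by norm_num)
  · calc _ ≤ 2 * M ^ 2 * (3 / v) ^ 3 := by gcongr
      _ = 54 * M ^ 2 / v ^ 3 := by ring
      _ ≤ 54 * M ^ 2 / (u * v) ^ 3 := by
        gcongr
        exact mul_le_of_le_one_left hv.le hu1

/-- **Claim 3.5**: bound on the third partial derivatives of `J_ρ`. -/
theorem third_derivative_bound (ρ : ℝ) (hρ0 : -1 < ρ) (hρ1 : ρ < 1) :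
    ∃ C : ℝ, 0 < C ∧ ∀ i j : ℕ, i + j = 3 → ∀ x y : ℝ,
      x ∈ Set.Ioo (0 : ℝ) 1 → y ∈ Set.Ioo (0 : ℝ) 1 →
      |(pdx^[i] (pdy^[j] (J ρ))) x y| ≤ C * (x * y * (1 - x) * (1 - y)) ^ (-C) := by
  have hσ : 0 < Real.sqrt (1 - ρ ^ 2) := Real.sqrt_pos.2 (one_sub_sq_pos hρ0 hρ1)
  have hσ1 : Real.sqrt (1 - ρ ^ 2) ≤ 1 := Real.sqrt_le_one.2 (by nlinarith [sq_nonneg ρ])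
  have hM : 1 ≤ 1 / Real.sqrt (1 - ρ ^ 2) := (one_le_div hσ).2 hσ1
  have h1 : |1 / Real.sqrt (1 - ρ ^ 2)| ≤ 1 / Real.sqrt (1 - ρ ^ 2) :=
    (abs_of_pos (by positivity)).le
  have h2 : |-ρ / Real.sqrt (1 - ρ ^ 2)| ≤ 1 / Real.sqrt (1 - ρ ^ 2) := by
    rw [abs_div, abs_neg, abs_of_pos hσ]
    gcongr
    exact (abs_lt.2 ⟨hρ0, hρ1⟩).le
  refine ⟨54 * (1 / Real.sqrt (1 - ρ ^ 2)) ^ 2, by positivity, fun i j hij x y hx hy => ?_⟩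
  have hX := second_derivative_bound hM h2 h1 (pdx_J hρ0 hρ1) hx hy
  have hY := second_derivative_bound hM h1 h2 (pdy_J hρ0 hρ1) hx hy
  obtain rfl : i = 3 - j := by omega
  have hj : j ≤ 3 := by omega
  interval_cases j
  · exact hX.1
  · exact hY.1
  · exact hY.2.1
  · exact hY.2.2

end DMN
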